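/- arXiv:2504.16763 — 6 statements merged into one kernel-verified Lean document; each statement's English description precedes it below -/
import Mathlib

section
/- Let E and F be finite-dimensional real inner product spaces, let A, C : E →L[ℝ] F be continuous linear maps, let α > 0, and let S be a subspace of F. Assume ‖A − C‖ ≤ α/2 (operator norm) and that ‖C* u‖ ≥ α·‖u‖ for every u ∈ S, where * denotes the adjoint. Then for every u ∈ S, ⟪u, (A ∘ C*) u⟫ ≥ (1/2)·‖C* u‖², and in particular ⟪u, (A ∘ C*) u⟫ ≥ (1/2)·⟪u, (C ∘ C*) u⟫. -/
open scoped RealInnerProductSpace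

/-- General matrix lemma: if `‖A − C‖ ≤ α/2` and the smallest singular value of `C*` on
the subspace `S` is at least `α`, then `⟪u, A C* u⟫ ≥ ½‖C* u‖² ≥ ½⟪u, C C* u⟫` on `S`. -/
theorem stmt_6
    {E F : Type*} [NormedAddCommGroup E] [InnerProductSpace ℝ E] [FiniteDimensional ℝ E]
    [NormedAddCommGroup F] [InnerProductSpace ℝ F] [FiniteDimensional ℝ F]
    (A C : E →L[ℝ] F) (α : ℝ) (hα : 0 < α) (S : Submodule ℝ F)
    (hAC : ‖A - C‖ ≤ α / 2)
    (hC : ∀ u ∈ S, α * ‖u‖ ≤ ‖ContinuousLinearMap.adjoint C u‖) :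
    ∀ u ∈ S,
      (1/2) * ‖ContinuousLinearMap.adjoint C u‖^2 ≤
          ⟪u, (A.comp (ContinuousLinearMap.adjoint C)) u⟫ ∧
      (1/2) * ⟪u, (C.comp (ContinuousLinearMap.adjoint C)) u⟫ ≤
          ⟪u, (A.comp (ContinuousLinearMap.adjoint C)) u⟫ := by
  intro u hu
  set w := ContinuousLinearMap.adjoint C u with hw
  have hCw : ⟪u, C w⟫ = ‖w‖ ^ 2 := by
    rw [← ContinuousLinearMap.adjoint_inner_left, ← hw, real_inner_self_eq_norm_sq]
  have hsplit : ⟪u, A w⟫ = ⟪u, (A - C) w⟫ + ⟪u, C w⟫ := by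
    rw [← inner_add_right, sub_apply, sub_add_cancel]
  have hdiff : |⟪u, (A - C) w⟫| ≤ (1/2) * ‖w‖ ^ 2 :=
    calc |⟪u, (A - C) w⟫| ≤ ‖u‖ * ‖(A - C) w‖ := abs_real_inner_le_norm _ _
      _ ≤ ‖u‖ * (α / 2 * ‖w‖) := by
        gcongr
        exact (A - C).le_of_opNorm_le hAC w
      _ = (1/2) * (α * ‖u‖ * ‖w‖) := by ring
      _ ≤ (1/2) * (‖w‖ * ‖w‖) := by
        gcongr
        exact hC u hu
      _ = (1/2) * ‖w‖ ^ 2 := by ring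
  have hmain : (1/2) * ‖w‖ ^ 2 ≤ ⟪u, A w⟫ := by
    linarith [neg_le_of_abs_le hdiff]
  simp only [ContinuousLinearMap.comp_apply, ← hw, hCw]
  exact ⟨hmain, hmain⟩
end

section
/- Let E and F be finite-dimensional real inner product spaces, let r ∈ F, and let J̄, J : E →L[ℝ] F be continuous linear maps. Let α ≥ 0, β > 0, and η be real numbers such that 0 < η ≤ 1/(2β²), ‖J̄‖ ≤ β (operator norm), ⟪r, (J̄ ∘ J*) r⟫ ≥ (1/2)·‖J* r‖², and ‖J* r‖ ≥ α·‖r‖, where * denotes the adjoint. Then ‖r − η (J̄ ∘ J*) r‖² ≤ (1 − η α² / 2)·‖r‖². -/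
open scoped RealInnerProductSpace

/-- One-step contraction of gradient descent: if `η ≤ 1/(2β²)`, `‖J̄‖ ≤ β`,
`⟪r, J̄ J* r⟫ ≥ ½‖J* r‖²` and `‖J* r‖ ≥ α‖r‖`, then
`‖r − η J̄ J* r‖² ≤ (1 − ηα²/2)‖r‖²`. -/
theorem stmt_7
    {E F : Type*} [NormedAddCommGroup E] [InnerProductSpace ℝ E] [FiniteDimensional ℝ E]
    [NormedAddCommGroup F] [InnerProductSpace ℝ F] [FiniteDimensional ℝ F]
    (r : F) (Jbar J : E →L[ℝ] F) (α β η : ℝ)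
    (hα : 0 ≤ α) (hβ : 0 < β) (hη0 : 0 < η) (hη : η ≤ 1 / (2 * β ^ 2))
    (hJbar : ‖Jbar‖ ≤ β)
    (hquad : (1/2) * ‖ContinuousLinearMap.adjoint J r‖ ^ 2 ≤
        ⟪r, (Jbar.comp (ContinuousLinearMap.adjoint J)) r⟫)
    (hlow : α * ‖r‖ ≤ ‖ContinuousLinearMap.adjoint J r‖) :
    ‖r - η • (Jbar.comp (ContinuousLinearMap.adjoint J)) r‖ ^ 2 ≤
      (1 - η * α ^ 2 / 2) * ‖r‖ ^ 2 := by
  rw [ContinuousLinearMap.comp_apply] at hquad ⊢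
  set g := ContinuousLinearMap.adjoint J r
  have hstep : η * β ^ 2 ≤ 1 / 2 := by
    rw [le_div_iff₀ (by positivity)] at hη
    linarith
  have hbound : ‖Jbar g‖ ^ 2 ≤ β ^ 2 * ‖g‖ ^ 2 := by
    rw [← mul_pow]
    gcongr
    exact Jbar.le_of_opNorm_le hJbar g
  have hgrad : α ^ 2 * ‖r‖ ^ 2 ≤ ‖g‖ ^ 2 := by
    rw [← mul_pow]
    gcongr
  rw [norm_sub_sq_real, real_inner_smul_right, norm_smul, mul_pow, Real.norm_eq_abs, sq_abs]
  calc ‖r‖ ^ 2 - 2 * (η * ⟪r, Jbar g⟫) + η ^ 2 * ‖Jbar g‖ ^ 2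
      ≤ ‖r‖ ^ 2 - 2 * (η * (1 / 2 * ‖g‖ ^ 2)) + η ^ 2 * (β ^ 2 * ‖g‖ ^ 2) := by gcongr
    _ = ‖r‖ ^ 2 - η * ‖g‖ ^ 2 + η * (η * β ^ 2) * ‖g‖ ^ 2 := by ring
    _ ≤ ‖r‖ ^ 2 - η * ‖g‖ ^ 2 + η * (1 / 2) * ‖g‖ ^ 2 := by gcongr
    _ = ‖r‖ ^ 2 - η / 2 * ‖g‖ ^ 2 := by ring
    _ ≤ ‖r‖ ^ 2 - η / 2 * (α ^ 2 * ‖r‖ ^ 2) := by gcongr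
    _ = (1 - η * α ^ 2 / 2) * ‖r‖ ^ 2 := by ring
end

section
/- Let E and F be finite-dimensional real inner product spaces, let f : E → F be continuously differentiable with Fréchet derivative Df, let y ∈ F, and let α ≥ 0, β > 0, and η satisfy 0 < η ≤ 1/(2β²). Define the gradient-descent sequence W_{t+1} = W_t − η (Df(W_t))*(f(W_t) − y) from an initial point W₀, and residuals r_t = f(W_t) − y. Fix T ∈ ℕ and suppose that for every t < T: (i) the average Jacobian J̄_t = ∫₀¹ Df(W_t + s(W_{t+1} − W_t)) ds satisfies ‖J̄_t‖ ≤ β; (ii) ⟪r_t, (J̄_t ∘ (Df(W_t))*) r_t⟫ ≥ (1/2)·‖(Df(W_t))* r_t‖²; and (iii) ‖(Df(W_t))* r_t‖ ≥ α·‖r_t‖. Then ‖r_T‖² ≤ (1 − η α²/2)^T · ‖r₀‖². -/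
open scoped RealInnerProductSpace

/-- The mean value identity: the increment of a `C¹` map is its average derivative along the segment
applied to the displacement. -/
theorem average_fderiv_apply_sub {E F : Type*} [NormedAddCommGroup E] [NormedSpace ℝ E]
    [NormedAddCommGroup F] [NormedSpace ℝ F] [CompleteSpace F]
    {f : E → F} (hf : ContDiff ℝ 1 f) (u v : E) :
    (∫ s in (0:ℝ)..1, fderiv ℝ f (u + s • (v - u))) (v - u) = f v - f u := by
  have hcont : Continuous fun s : ℝ => fderiv ℝ f (u + s • (v - u)) :=
    (hf.continuous_fderiv one_ne_zero).comp (by fun_prop)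
  rw [ContinuousLinearMap.intervalIntegral_apply (hcont.intervalIntegrable 0 1),
    intervalIntegral.integral_eq_sub_of_hasDerivAt (f := fun s : ℝ => f (u + s • (v - u)))]
  · simp
  · intro s _
    have hline : HasDerivAt (fun s : ℝ => u + s • (v - u)) (v - u) s := by
      simpa using ((hasDerivAt_id s).smul_const (v - u)).const_add u
    exact ((hf.differentiable one_ne_zero) _).hasFDerivAt.comp_hasDerivAt s hline
  · exact (hcont.clm_apply continuous_const).intervalIntegrable 0 1

/-- Iterating a linear contraction bound on a nonnegative sequence; the ratio may have any sign. -/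
theorem le_pow_mul_of_succ_le_mul {a : ℕ → ℝ} {c : ℝ} (ha : ∀ t, 0 ≤ a t) (T : ℕ)
    (h : ∀ t < T, a (t + 1) ≤ c * a t) : a T ≤ c ^ T * a 0 := by
  rcases le_or_gt 0 c with hc | hc
  · induction T with
    | zero => simp
    | succ n ih =>
      calc a (n + 1) ≤ c * a n := h n n.lt_succ_self
        _ ≤ c * (c ^ n * a 0) :=
          mul_le_mul_of_nonneg_left (ih fun t ht => h t (ht.trans n.lt_succ_self)) hc
        _ = c ^ (n + 1) * a 0 := by ring
  · have hzero : ∀ t < T, a t = 0 := fun t ht => by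
      nlinarith [ha t, ha (t + 1), h t ht]
    cases T with
    | zero => simp
    | succ n =>
      have hn := h n n.lt_succ_self
      rw [hzero n n.lt_succ_self] at hn
      rw [hzero 0 n.succ_pos]
      simpa using hn

/-- One-step contraction of the squared norm: `r` is the residual, `g` the gradient and `A` the
average Jacobian. -/
theorem norm_sub_smul_apply_sq_le {E F : Type*} [NormedAddCommGroup E] [NormedSpace ℝ E]
    [NormedAddCommGroup F] [InnerProductSpace ℝ F] (A : E →L[ℝ] F) (g : E) (r : F)
    {α β η : ℝ} (hα : 0 ≤ α) (hβ : 0 < β) (hη0 : 0 < η) (hη : η ≤ 1 / (2 * β ^ 2))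
    (hA : ‖A‖ ≤ β) (hquad : (1 / 2) * ‖g‖ ^ 2 ≤ ⟪r, A g⟫) (hlow : α * ‖r‖ ≤ ‖g‖) :
    ‖r - η • A g‖ ^ 2 ≤ (1 - η * α ^ 2 / 2) * ‖r‖ ^ 2 := by
  have hAg : ‖A g‖ ^ 2 ≤ β ^ 2 * ‖g‖ ^ 2 := by
    rw [← mul_pow]
    exact pow_le_pow_left₀ (norm_nonneg _) (A.le_of_opNorm_le hA g) 2
  have hηβ : η * β ^ 2 ≤ 1 / 2 := by
    rw [le_div_iff₀ (by positivity)] at hη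
    linarith
  have hg : α ^ 2 * ‖r‖ ^ 2 ≤ ‖g‖ ^ 2 := by
    rw [← mul_pow]
    exact pow_le_pow_left₀ (by positivity) hlow 2
  rw [norm_sub_sq_real, inner_smul_right, norm_smul, mul_pow, Real.norm_eq_abs, sq_abs]
  have h₁ := mul_le_mul_of_nonneg_left hquad hη0.le
  have h₂ := mul_le_mul_of_nonneg_left hAg (sq_nonneg η)
  have h₃ := mul_le_mul_of_nonneg_left hηβ (mul_nonneg hη0.le (sq_nonneg ‖g‖))
  have h₄ := mul_le_mul_of_nonneg_left hg hη0.le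
  linarith

/-- Geometric decay of the residual of gradient descent on the MSE loss:
under the per-step conditions (i)–(iii) for all `t < T`,
`‖r_T‖² ≤ (1 − ηα²/2)^T ‖r₀‖²`. -/
theorem stmt_8
    {E F : Type*} [NormedAddCommGroup E] [InnerProductSpace ℝ E] [FiniteDimensional ℝ E]
    [NormedAddCommGroup F] [InnerProductSpace ℝ F] [FiniteDimensional ℝ F]
    (f : E → F) (hf : ContDiff ℝ 1 f) (y : F)
    (α β η : ℝ) (hα : 0 ≤ α) (hβ : 0 < β) (hη0 : 0 < η) (hη : η ≤ 1 / (2 * β ^ 2))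
    (W : ℕ → E)
    (hW : ∀ t : ℕ, W (t + 1) =
        W t - η • (ContinuousLinearMap.adjoint (fderiv ℝ f (W t))) (f (W t) - y))
    (T : ℕ)
    (hJbar : ∀ t < T,
        ‖∫ s in (0:ℝ)..1, fderiv ℝ f (W t + s • (W (t + 1) - W t))‖ ≤ β)
    (hquad : ∀ t < T,
        (1/2) * ‖ContinuousLinearMap.adjoint (fderiv ℝ f (W t)) (f (W t) - y)‖ ^ 2 ≤
          ⟪f (W t) - y,
            ((∫ s in (0:ℝ)..1, fderiv ℝ f (W t + s • (W (t + 1) - W t))).comp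
              (ContinuousLinearMap.adjoint (fderiv ℝ f (W t)))) (f (W t) - y)⟫)
    (hlow : ∀ t < T,
        α * ‖f (W t) - y‖ ≤
          ‖ContinuousLinearMap.adjoint (fderiv ℝ f (W t)) (f (W t) - y)‖) :
    ‖f (W T) - y‖ ^ 2 ≤ (1 - η * α ^ 2 / 2) ^ T * ‖f (W 0) - y‖ ^ 2 := by
  refine le_pow_mul_of_succ_le_mul (a := fun t => ‖f (W t) - y‖ ^ 2) (fun t => sq_nonneg _) T
    fun t ht => ?_
  have hstep := average_fderiv_apply_sub hf (W t) (W (t + 1))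
  have hbound := norm_sub_smul_apply_sq_le _ _ _ hα hβ hη0 hη (hJbar t ht) (hquad t ht) (hlow t ht)
  have hdiff : W (t + 1) - W t =
      -(η • ContinuousLinearMap.adjoint (fderiv ℝ f (W t)) (f (W t) - y)) := by
    rw [hW t]
    abel
  generalize (∫ s in (0:ℝ)..1, fderiv ℝ f (W t + s • (W (t + 1) - W t))) = A at hstep hbound
  rw [hdiff, map_neg, map_smul] at hstep
  have hres : f (W (t + 1)) - y = f (W t) - y -
      η • A (ContinuousLinearMap.adjoint (fderiv ℝ f (W t)) (f (W t) - y)) := by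
    rw [sub_eq_add_neg _ (η • _), hstep]
    abel
  simpa only [hres] using hbound
end

section
/- Let E and F be finite-dimensional real inner product spaces, let r ∈ F, and let J̄, J, E₁, E₂ : E →L[ℝ] F be continuous linear maps. Let α, β, ε₁, ε₂, η be real numbers with 0 ≤ α ≤ β, ε₁ ≥ 0, ε₂ ≥ 0, 0 < η ≤ 1/(2β²), ‖J̄‖ ≤ β, ‖J‖ ≤ β, ‖E₁‖ ≤ ε₁, ‖E₂‖ ≤ ε₂ (operator norms), ⟪r, (J̄ ∘ J*) r⟫ ≥ (1/2)·‖J* r‖², and ‖J* r‖ ≥ α·‖r‖. Then ‖r − η ((J̄ + E₂) ∘ (J + E₁)*) r‖ ≤ (√(1 − η α²/2) + η·(β ε₁ + β ε₂ + ε₁ ε₂))·‖r‖. -/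
open scoped RealInnerProductSpace

/-- One gradient step `r ↦ r - η A u` contracts when `A u` is sufficiently aligned with `r`. -/
theorem norm_sub_smul_apply_le_sqrt_mul {E F : Type*}
    [NormedAddCommGroup E] [NormedSpace ℝ E] [NormedAddCommGroup F] [InnerProductSpace ℝ F]
    {A : E →L[ℝ] F} {u : E} {r : F} {α β η : ℝ} (hα : 0 ≤ α) (hη0 : 0 ≤ η)
    (hη : η * β ^ 2 ≤ 1 / 2) (hA : ‖A‖ ≤ β) (hquad : (1 / 2) * ‖u‖ ^ 2 ≤ ⟪r, A u⟫)
    (hlow : α * ‖r‖ ≤ ‖u‖) :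
    ‖r - η • A u‖ ≤ √(1 - η * α ^ 2 / 2) * ‖r‖ := by
  have hAu : ‖A u‖ ^ 2 ≤ β ^ 2 * ‖u‖ ^ 2 := by
    rw [← mul_pow]
    exact pow_le_pow_left₀ (norm_nonneg _) (A.le_of_opNorm_le hA u) 2
  have hu : α ^ 2 * ‖r‖ ^ 2 ≤ ‖u‖ ^ 2 := by
    rw [← mul_pow]
    exact pow_le_pow_left₀ (by positivity) hlow 2
  have hsq : ‖r - η • A u‖ ^ 2 ≤ (1 - η * α ^ 2 / 2) * ‖r‖ ^ 2 := by
    rw [norm_sub_sq_real, inner_smul_right, norm_smul, mul_pow, Real.norm_eq_abs, sq_abs]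
    have h1 := mul_le_mul_of_nonneg_left hquad hη0
    have h2 := mul_le_mul_of_nonneg_left hAu (sq_nonneg η)
    have h3 := mul_le_mul_of_nonneg_left hη (mul_nonneg hη0 (sq_nonneg ‖u‖))
    have h4 := mul_le_mul_of_nonneg_left hu hη0
    linarith
  calc ‖r - η • A u‖ ≤ √((1 - η * α ^ 2 / 2) * ‖r‖ ^ 2) := Real.le_sqrt_of_sq_le hsq
    _ = √(1 - η * α ^ 2 / 2) * ‖r‖ := by
      rw [Real.sqrt_mul' _ (sq_nonneg _), Real.sqrt_sq (norm_nonneg _)]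

/-- Perturbed-data one-step contraction: with Jacobian errors `‖E₁‖ ≤ ε₁`, `‖E₂‖ ≤ ε₂`,
the residual update still contracts with factor
`√(1 − ηα²/2) + η(βε₁ + βε₂ + ε₁ε₂)`. -/
theorem stmt_12
    {E F : Type*} [NormedAddCommGroup E] [InnerProductSpace ℝ E] [FiniteDimensional ℝ E]
    [NormedAddCommGroup F] [InnerProductSpace ℝ F] [FiniteDimensional ℝ F]
    (r : F) (Jbar J E₁ E₂ : E →L[ℝ] F) (α β ε₁ ε₂ η : ℝ)
    (hα : 0 ≤ α) (hαβ : α ≤ β) (hε₁ : 0 ≤ ε₁) (hε₂ : 0 ≤ ε₂)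
    (hη0 : 0 < η) (hη : η ≤ 1 / (2 * β ^ 2))
    (hJbar : ‖Jbar‖ ≤ β) (hJ : ‖J‖ ≤ β) (hE₁ : ‖E₁‖ ≤ ε₁) (hE₂ : ‖E₂‖ ≤ ε₂)
    (hquad : (1/2) * ‖ContinuousLinearMap.adjoint J r‖ ^ 2 ≤
        ⟪r, (Jbar.comp (ContinuousLinearMap.adjoint J)) r⟫)
    (hlow : α * ‖r‖ ≤ ‖ContinuousLinearMap.adjoint J r‖) :
    ‖r - η • ((Jbar + E₂).comp (ContinuousLinearMap.adjoint (J + E₁))) r‖ ≤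
      (Real.sqrt (1 - η * α ^ 2 / 2) + η * (β * ε₁ + β * ε₂ + ε₁ * ε₂)) * ‖r‖ := by
  have hβ : η * β ^ 2 ≤ 1 / 2 := by
    have hpos : 0 < 2 * β ^ 2 := one_div_pos.mp (hη0.trans_le hη)
    rw [le_div_iff₀ hpos] at hη
    linarith
  have hβ0 : 0 ≤ β := hα.trans hαβ
  have hadj {B : E →L[ℝ] F} {b : ℝ} (hB : ‖B‖ ≤ b) :
      ‖ContinuousLinearMap.adjoint B r‖ ≤ b * ‖r‖ :=
    (ContinuousLinearMap.adjoint B).le_of_opNorm_le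
      ((LinearIsometryEquiv.norm_map _ B).trans_le hB) r
  have hclean := norm_sub_smul_apply_le_sqrt_mul hα hη0.le hβ hJbar hquad hlow
  set u := ContinuousLinearMap.adjoint J r
  set v := ContinuousLinearMap.adjoint E₁ r
  have hsplit : r - η • ((Jbar + E₂).comp (ContinuousLinearMap.adjoint (J + E₁))) r =
      (r - η • Jbar u) - η • (Jbar v + E₂ u + E₂ v) := by
    simp only [map_add, ContinuousLinearMap.comp_apply, add_apply, u, v]
    module
  have herr : ‖Jbar v + E₂ u + E₂ v‖ ≤ (β * ε₁ + β * ε₂ + ε₁ * ε₂) * ‖r‖ := by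
    calc ‖Jbar v + E₂ u + E₂ v‖ ≤ ‖Jbar v‖ + ‖E₂ u‖ + ‖E₂ v‖ := norm_add₃_le
      _ ≤ β * (ε₁ * ‖r‖) + ε₂ * (β * ‖r‖) + ε₂ * (ε₁ * ‖r‖) := by
        gcongr
        · exact Jbar.le_of_opNorm_le_of_le hJbar (hadj hE₁)
        · exact E₂.le_of_opNorm_le_of_le hE₂ (hadj hJ)
        · exact E₂.le_of_opNorm_le_of_le hE₂ (hadj hE₁)
      _ = (β * ε₁ + β * ε₂ + ε₁ * ε₂) * ‖r‖ := by ring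
  rw [hsplit, add_mul, mul_assoc η]
  refine (norm_sub_le _ _).trans (add_le_add hclean ?_)
  rw [norm_smul, Real.norm_of_nonneg hη0.le]
  exact mul_le_mul_of_nonneg_left herr hη0.le
end

section
/- Let E and F be finite-dimensional real inner product spaces, let f : E → F be continuously differentiable with Fréchet derivative Df, let y ∈ F, and let α, β, η, ν be real numbers with 0 < α ≤ β, 0 < η ≤ 1/(2β²), and ν > 0. Define W_{t+1} = W_t − η (Df(W_t))*(f(W_t) − y) from an initial point W₀, and r_t = f(W_t) − y, and assume ‖r₀‖ > 0. Suppose that for every t ∈ ℕ: (i) the average Jacobian J̄_t = ∫₀¹ Df(W_t + s(W_{t+1} − W_t)) ds satisfies ‖J̄_t‖ ≤ β; (ii) ⟪r_t, (J̄_t ∘ (Df(W_t))*) r_t⟫ ≥ (1/2)·‖(Df(W_t))* r_t‖²; and (iii) ‖(Df(W_t))* r_t‖ ≥ α·‖r_t‖. Then for every natural number T with (T : ℝ) ≥ (8/(η α²))·log(‖r₀‖/ν), one has ‖r_T‖ ≤ ν. -/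
open scoped RealInnerProductSpace

/-- The increment of a `C¹` map along a segment is the average derivative applied to the
displacement. -/
theorem sub_eq_integral_fderiv_apply
    {E F : Type*} [NormedAddCommGroup E] [NormedSpace ℝ E]
    [NormedAddCommGroup F] [NormedSpace ℝ F] [CompleteSpace F]
    {f : E → F} (hf : ContDiff ℝ 1 f) (u v : E) :
    f v - f u = (∫ s in (0:ℝ)..1, fderiv ℝ f (u + s • (v - u))) (v - u) := by
  have hcont : Continuous fun s : ℝ => fderiv ℝ f (u + s • (v - u)) :=
    (hf.continuous_fderiv one_ne_zero).comp (by fun_prop)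
  rw [ContinuousLinearMap.intervalIntegral_apply (hcont.intervalIntegrable 0 1)]
  have hderiv : ∀ s ∈ Set.uIcc (0:ℝ) 1, HasDerivAt (fun s : ℝ => f (u + s • (v - u)))
      (fderiv ℝ f (u + s • (v - u)) (v - u)) s := by
    intro s _
    have hline : HasDerivAt (fun s : ℝ => u + s • (v - u)) (v - u) s := by
      simpa using ((hasDerivAt_id s).smul_const (v - u)).const_add u
    exact ((hf.differentiable one_ne_zero) _).hasFDerivAt.comp_hasDerivAt s hline
  rw [intervalIntegral.integral_eq_sub_of_hasDerivAt hderiv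
    ((hcont.clm_apply continuous_const).intervalIntegrable 0 1)]
  simp

/-- One step `r ↦ r - η J g` contracts the squared norm by the factor `1 - ηα²/2`. -/
theorem norm_sub_smul_sq_le
    {E F : Type*} [NormedAddCommGroup E] [InnerProductSpace ℝ E]
    [NormedAddCommGroup F] [InnerProductSpace ℝ F]
    {J : E →L[ℝ] F} {g : E} {r : F} {α β η : ℝ} (hα : 0 ≤ α) (hβ : 0 < β) (hη0 : 0 ≤ η)
    (hη : η ≤ 1 / (2 * β ^ 2)) (hJ : ‖J‖ ≤ β) (hquad : (1/2) * ‖g‖ ^ 2 ≤ ⟪r, J g⟫)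
    (hlow : α * ‖r‖ ≤ ‖g‖) :
    ‖r - η • J g‖ ^ 2 ≤ (1 - η * α ^ 2 / 2) * ‖r‖ ^ 2 := by
  have hηβ : η * β ^ 2 ≤ 1 / 2 := by
    rw [le_div_iff₀ (by positivity)] at hη
    linarith
  have hJg : ‖J g‖ ^ 2 ≤ β ^ 2 * ‖g‖ ^ 2 := by
    rw [← mul_pow]
    exact pow_le_pow_left₀ (norm_nonneg _) (J.le_of_opNorm_le hJ g) 2
  have hg : α ^ 2 * ‖r‖ ^ 2 ≤ ‖g‖ ^ 2 := by
    rw [← mul_pow]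
    exact pow_le_pow_left₀ (by positivity) hlow 2
  calc ‖r - η • J g‖ ^ 2
      = ‖r‖ ^ 2 - 2 * η * ⟪r, J g⟫ + η ^ 2 * ‖J g‖ ^ 2 := by
        rw [norm_sub_sq_real, real_inner_smul_right, norm_smul, mul_pow, Real.norm_eq_abs, sq_abs]
        ring
    _ ≤ ‖r‖ ^ 2 - 2 * η * ((1/2) * ‖g‖ ^ 2) + η ^ 2 * (β ^ 2 * ‖g‖ ^ 2) := by gcongr
    _ = ‖r‖ ^ 2 - η * (1 - η * β ^ 2) * ‖g‖ ^ 2 := by ring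
    _ ≤ ‖r‖ ^ 2 - η * (1 - 1 / 2) * (α ^ 2 * ‖r‖ ^ 2) := by
        have : 0 ≤ 1 - η * β ^ 2 := by linarith
        gcongr
    _ = (1 - η * α ^ 2 / 2) * ‖r‖ ^ 2 := by ring

/-- A nonnegative sequence whose squares contract by `1 - c/2` is at most `ν` after
`(8/c) log (a 0 / ν)` steps. -/
theorem le_of_sq_contraction {a : ℕ → ℝ} {c ν : ℝ} (ha0 : 0 < a 0)
    (hc : 0 < c) (hν : 0 < ν) (hstep : ∀ t, a (t + 1) ^ 2 ≤ (1 - c / 2) * a t ^ 2)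
    {T : ℕ} (hT : (8 / c) * Real.log (a 0 / ν) ≤ T) : a T ≤ ν := by
  have hdecay : ∀ t : ℕ, a t ^ 2 ≤ Real.exp (-(c / 2) * t) * a 0 ^ 2 := by
    intro t
    induction t with
    | zero => simp
    | succ t ih =>
      calc a (t + 1) ^ 2 ≤ (1 - c / 2) * a t ^ 2 := hstep t
        _ ≤ Real.exp (-(c / 2)) * a t ^ 2 := by
          gcongr
          linarith [Real.add_one_le_exp (-(c / 2))]
        _ ≤ Real.exp (-(c / 2)) * (Real.exp (-(c / 2) * t) * a 0 ^ 2) := by gcongr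
        _ = Real.exp (-(c / 2) * (t + 1 : ℕ)) * a 0 ^ 2 := by
          rw [← mul_assoc, ← Real.exp_add]
          push_cast
          ring_nf
  have hlog : 2 * Real.log (a 0 / ν) ≤ c / 2 * T := by
    have hT' : 8 * Real.log (a 0 / ν) ≤ T * c := by
      rwa [div_mul_eq_mul_div, div_le_iff₀ hc] at hT
    have : 0 ≤ T * c := by positivity
    linarith
  refine (abs_le_of_sq_le_sq' ?_ hν.le).2
  calc a T ^ 2 ≤ Real.exp (-(c / 2) * T) * a 0 ^ 2 := hdecay T
    _ ≤ Real.exp (-(2 * Real.log (a 0 / ν))) * a 0 ^ 2 := by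
      gcongr
      linarith
    _ = ν ^ 2 := by
      rw [Real.exp_neg, two_mul, Real.exp_add, Real.exp_log (div_pos ha0 hν)]
      field_simp

/-- Main guarantee (clean case): under the per-step conditions (i)–(iii) at every
iteration, after `T ≥ (8/(ηα²))·log(‖r₀‖/ν)` gradient-descent iterations on the MSE
loss the residual satisfies `‖r_T‖ ≤ ν`. -/
theorem stmt_13
    {E F : Type*} [NormedAddCommGroup E] [InnerProductSpace ℝ E] [FiniteDimensional ℝ E]
    [NormedAddCommGroup F] [InnerProductSpace ℝ F] [FiniteDimensional ℝ F]
    (f : E → F) (hf : ContDiff ℝ 1 f) (y : F)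
    (α β η ν : ℝ) (hα : 0 < α) (hαβ : α ≤ β) (hη0 : 0 < η) (hη : η ≤ 1 / (2 * β ^ 2))
    (hν : 0 < ν)
    (W : ℕ → E)
    (hW : ∀ t : ℕ, W (t + 1) =
        W t - η • (ContinuousLinearMap.adjoint (fderiv ℝ f (W t))) (f (W t) - y))
    (hr0 : 0 < ‖f (W 0) - y‖)
    (hJbar : ∀ t : ℕ,
        ‖∫ s in (0:ℝ)..1, fderiv ℝ f (W t + s • (W (t + 1) - W t))‖ ≤ β)
    (hquad : ∀ t : ℕ,
        (1/2) * ‖ContinuousLinearMap.adjoint (fderiv ℝ f (W t)) (f (W t) - y)‖ ^ 2 ≤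
          ⟪f (W t) - y,
            ((∫ s in (0:ℝ)..1, fderiv ℝ f (W t + s • (W (t + 1) - W t))).comp
              (ContinuousLinearMap.adjoint (fderiv ℝ f (W t)))) (f (W t) - y)⟫)
    (hlow : ∀ t : ℕ,
        α * ‖f (W t) - y‖ ≤
          ‖ContinuousLinearMap.adjoint (fderiv ℝ f (W t)) (f (W t) - y)‖)
    (T : ℕ) (hT : (8 / (η * α ^ 2)) * Real.log (‖f (W 0) - y‖ / ν) ≤ (T : ℝ)) :
    ‖f (W T) - y‖ ≤ ν := by
  have hβ : 0 < β := hα.trans_le hαβ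
  refine le_of_sq_contraction (a := fun t => ‖f (W t) - y‖) hr0
    (mul_pos hη0 (pow_pos hα 2)) hν (fun t => ?_) hT
  have hresidual : f (W (t + 1)) - y = (f (W t) - y) -
      η • (∫ s in (0:ℝ)..1, fderiv ℝ f (W t + s • (W (t + 1) - W t)))
        (ContinuousLinearMap.adjoint (fderiv ℝ f (W t)) (f (W t) - y)) := by
    have hdisp : W (t + 1) - W t =
        -(η • ContinuousLinearMap.adjoint (fderiv ℝ f (W t)) (f (W t) - y)) := by
      rw [hW t]
      abel
    have hincr := sub_eq_integral_fderiv_apply hf (W t) (W (t + 1))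
    generalize (∫ s in (0:ℝ)..1, fderiv ℝ f (W t + s • (W (t + 1) - W t))) = J at hincr ⊢
    rw [hdisp, map_neg, map_smul, sub_eq_iff_eq_add] at hincr
    rw [hincr]
    abel
  simp only [hresidual]
  exact norm_sub_smul_sq_le hα.le hβ hη0.le hη (hJbar t) (hquad t) (hlow t)
end

section
/- Let E and F be finite-dimensional real inner product spaces, and let α, β, ε₁, ε₂, η be real numbers with 0 ≤ α ≤ β, ε₁ ≥ 0, ε₂ ≥ 0, and 0 < η ≤ 1/(2β²). Let (r_t) be a sequence in F and, for each t, let J̄_t, J_t, E_{1,t}, E_{2,t} : E →L[ℝ] F be continuous linear maps such that r_{t+1} = r_t − η ((J̄_t + E_{2,t}) ∘ (J_t + E_{1,t})*) r_t, ‖J̄_t‖ ≤ β, ‖J_t‖ ≤ β, ‖E_{1,t}‖ ≤ ε₁, ‖E_{2,t}‖ ≤ ε₂, ⟪r_t, (J̄_t ∘ J_t*) r_t⟫ ≥ (1/2)·‖J_t* r_t‖², and ‖J_t* r_t‖ ≥ α·‖r_t‖. Then, setting q = √(1 − η α²/2) + η·(β ε₁ + β ε₂ + ε₁ ε₂), for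 every T ∈ ℕ one has ‖r_T‖ ≤ q^T · ‖r₀‖. -/
open scoped RealInnerProductSpace

open ContinuousLinearMap in
/-- One unperturbed step `x - η A B* x` contracts `x`. -/
theorem norm_sub_smul_comp_adjoint_le
    {E F : Type*} [NormedAddCommGroup E] [InnerProductSpace ℝ E] [CompleteSpace E]
    [NormedAddCommGroup F] [InnerProductSpace ℝ F] [CompleteSpace F]
    {α β η : ℝ} (hα : 0 ≤ α) (hη : 0 ≤ η) (hηβ : η * β ^ 2 ≤ 1 / 2)
    {A B : E →L[ℝ] F} (hA : ‖A‖ ≤ β) {x : F}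
    (hquad : (1 / 2) * ‖adjoint B x‖ ^ 2 ≤ ⟪x, A (adjoint B x)⟫)
    (hlow : α * ‖x‖ ≤ ‖adjoint B x‖) :
    ‖x - η • A (adjoint B x)‖ ≤ √(1 - η * α ^ 2 / 2) * ‖x‖ := by
  set v := adjoint B x
  have hAv : ‖A v‖ ^ 2 ≤ β ^ 2 * ‖v‖ ^ 2 := by
    rw [← mul_pow]
    exact pow_le_pow_left₀ (norm_nonneg _) (A.le_of_opNorm_le hA v) 2
  have hv : α ^ 2 * ‖x‖ ^ 2 ≤ ‖v‖ ^ 2 := by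
    rw [← mul_pow]
    exact pow_le_pow_left₀ (by positivity) hlow 2
  have hsq : ‖x - η • A v‖ ^ 2 ≤ (1 - η * α ^ 2 / 2) * ‖x‖ ^ 2 := by
    rw [norm_sub_sq_real, real_inner_smul_right, norm_smul, mul_pow, Real.norm_eq_abs, sq_abs]
    have h₁ := mul_le_mul_of_nonneg_left hquad hη
    have h₂ := mul_le_mul_of_nonneg_left hAv (sq_nonneg η)
    have h₃ := mul_le_mul_of_nonneg_right hηβ (mul_nonneg hη (sq_nonneg ‖v‖))
    have h₄ := mul_le_mul_of_nonneg_left hv hη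
    linarith
  calc ‖x - η • A v‖ ≤ √((1 - η * α ^ 2 / 2) * ‖x‖ ^ 2) := Real.le_sqrt_of_sq_le hsq
    _ = √(1 - η * α ^ 2 / 2) * ‖x‖ := by
      rw [Real.sqrt_mul' _ (sq_nonneg _), Real.sqrt_sq (norm_nonneg _)]

open ContinuousLinearMap in
/-- Perturbing both factors of `A B*` additively changes it by at most
`β ε₁ + β ε₂ + ε₁ ε₂` in norm. -/
theorem norm_perturbed_comp_adjoint_sub_le
    {E F : Type*} [NormedAddCommGroup E] [InnerProductSpace ℝ E] [CompleteSpace E]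
    [NormedAddCommGroup F] [InnerProductSpace ℝ F] [CompleteSpace F]
    {β ε₁ ε₂ : ℝ} {A B P Q : E →L[ℝ] F} (hA : ‖A‖ ≤ β) (hB : ‖B‖ ≤ β)
    (hP : ‖P‖ ≤ ε₁) (hQ : ‖Q‖ ≤ ε₂) :
    ‖(A + Q).comp (adjoint (B + P)) - A.comp (adjoint B)‖ ≤ β * ε₁ + β * ε₂ + ε₁ * ε₂ := by
  have hcomp : ∀ {C D : E →L[ℝ] F} {c d : ℝ}, ‖C‖ ≤ c → ‖D‖ ≤ d →
      ‖C.comp (adjoint D)‖ ≤ c * d := fun {C D c d} hC hD =>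
    (opNorm_comp_le _ _).trans <| by
      rw [LinearIsometryEquiv.norm_map]
      exact mul_le_mul hC hD (norm_nonneg _) ((norm_nonneg _).trans hC)
  have hdecomp : (A + Q).comp (adjoint (B + P)) - A.comp (adjoint B) =
      A.comp (adjoint P) + Q.comp (adjoint B) + Q.comp (adjoint P) := by
    rw [map_add, add_comp, comp_add, comp_add]
    abel
  rw [hdecomp]
  refine (norm_add₃_le).trans ?_
  linarith [hcomp hA hP, hcomp hQ hB, hcomp hQ hP]

/-- Multi-step geometric decay of the residual under instance noise: iterating the
perturbed one-step contraction gives `‖r_T‖ ≤ q^T ‖r₀‖` with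
`q = √(1 − ηα²/2) + η(βε₁ + βε₂ + ε₁ε₂)`. -/
theorem stmt_14
    {E F : Type*} [NormedAddCommGroup E] [InnerProductSpace ℝ E] [FiniteDimensional ℝ E]
    [NormedAddCommGroup F] [InnerProductSpace ℝ F] [FiniteDimensional ℝ F]
    (α β ε₁ ε₂ η : ℝ) (hα : 0 ≤ α) (hαβ : α ≤ β) (hε₁ : 0 ≤ ε₁) (hε₂ : 0 ≤ ε₂)
    (hη0 : 0 < η) (hη : η ≤ 1 / (2 * β ^ 2))
    (r : ℕ → F) (Jbar J E₁ E₂ : ℕ → (E →L[ℝ] F))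
    (hrec : ∀ t : ℕ, r (t + 1) =
        r t - η • ((Jbar t + E₂ t).comp
          (ContinuousLinearMap.adjoint (J t + E₁ t))) (r t))
    (hJbar : ∀ t, ‖Jbar t‖ ≤ β) (hJ : ∀ t, ‖J t‖ ≤ β)
    (hE₁ : ∀ t, ‖E₁ t‖ ≤ ε₁) (hE₂ : ∀ t, ‖E₂ t‖ ≤ ε₂)
    (hquad : ∀ t, (1/2) * ‖ContinuousLinearMap.adjoint (J t) (r t)‖ ^ 2 ≤
        ⟪r t, ((Jbar t).comp (ContinuousLinearMap.adjoint (J t))) (r t)⟫)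
    (hlow : ∀ t, α * ‖r t‖ ≤ ‖ContinuousLinearMap.adjoint (J t) (r t)‖)
    (T : ℕ) :
    ‖r T‖ ≤
      (Real.sqrt (1 - η * α ^ 2 / 2) + η * (β * ε₁ + β * ε₂ + ε₁ * ε₂)) ^ T * ‖r 0‖ := by
  have hβ : 0 ≤ β := hα.trans hαβ
  have hηβ : η * β ^ 2 ≤ 1 / 2 := by
    rcases hβ.eq_or_lt with rfl | hβ
    · norm_num
    · rw [le_div_iff₀ (by positivity)] at hη
      linarith
  induction T with
  | zero => simp
  | succ t ih =>
    set M := (Jbar t + E₂ t).comp (ContinuousLinearMap.adjoint (J t + E₁ t))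
    set N := (Jbar t).comp (ContinuousLinearMap.adjoint (J t))
    have hclean : ‖r t - η • N (r t)‖ ≤ √(1 - η * α ^ 2 / 2) * ‖r t‖ :=
      norm_sub_smul_comp_adjoint_le hα hη0.le hηβ (hJbar t) (hquad t) (hlow t)
    have hpert : ‖(M - N) (r t)‖ ≤ (β * ε₁ + β * ε₂ + ε₁ * ε₂) * ‖r t‖ :=
      (M - N).le_of_opNorm_le
        (norm_perturbed_comp_adjoint_sub_le (hJbar t) (hJ t) (hE₁ t) (hE₂ t)) (r t)
    have hsplit : r (t + 1) = (r t - η • N (r t)) - η • (M - N) (r t) := by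
      rw [hrec t, sub_apply, smul_sub]
      abel
    have hstep : ‖r (t + 1)‖ ≤
        (√(1 - η * α ^ 2 / 2) + η * (β * ε₁ + β * ε₂ + ε₁ * ε₂)) * ‖r t‖ := by
      rw [hsplit, add_mul, mul_assoc η]
      refine (norm_sub_le _ _).trans (add_le_add hclean ?_)
      rw [norm_smul, Real.norm_of_nonneg hη0.le]
      exact mul_le_mul_of_nonneg_left hpert hη0.le
    rw [pow_succ', mul_assoc]
    exact hstep.trans (mul_le_mul_of_nonneg_left ih (by positivity))
end
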